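/- Let O_x be a regular local ring and E a finitely generated O_x-module. Then E is free if and only if Ext^i_{O_x}(E, O_x) = 0 for all i > 0. -/

import Mathlib

/-!
STATEMENT 6.  Let `O_x` be a (commutative Noetherian) regular local ring and `E` a finitely
generated `O_x`-module.  Then `E` is free iff `Ext^i(E, O_x) = 0` for all `i > 0`.
-/

open CategoryTheory

/-- A commutative Noetherian local ring is *regular* if its maximal ideal can be generated
by `dim R` elements. -/
def IsRegularLocal (R : Type) [CommRing R] [IsLocalRing R] [IsNoetherianRing R] : Prop :=
  ∃ s : Finset R, Ideal.span (s : Set R) = IsLocalRing.maximalIdeal R ∧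
    (s.card : WithBot (WithTop ℕ)) = ringKrullDim R


/-- a surjection from a finite free module such that functionals on the kernel extend -/
def FreeCover (R : Type) [CommRing R] (M : Type) [AddCommGroup M] [Module R M] (k : ℕ)
    (f : (Fin k → R) →ₗ[R] M) : Prop :=
  Function.Surjective f ∧ ∀ φ : LinearMap.ker f →ₗ[R] R, ∃ ψ : (Fin k → R) →ₗ[R] R,
    ∀ v : LinearMap.ker f, ψ v = φ v

def ClosedPred (R : Type) [CommRing R] (Q : ModuleCat.{0} R → Prop) : Prop :=
  ∀ M, Q M → ∃ k, ∃ f : (Fin k → R) →ₗ[R] M, FreeCover R M k f ∧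
    Q (ModuleCat.of R (LinearMap.ker f))

def Good (R : Type) [CommRing R] (E : Type) [AddCommGroup E] [Module R E] : Prop :=
  ∃ Q : ModuleCat.{0} R → Prop, ClosedPred R Q ∧ Q (ModuleCat.of R E)

/-- lifting functionals mod `x` -/
lemma lift_functional {R S : Type} [CommRing R] [CommRing S] (σ : R →+* S)
    (hσ : Function.Surjective σ) (x : R) (hker : ∀ r, σ r = 0 ↔ ∃ a, r = x * a)
    (hx : ∀ a b : R, x * a = x * b → a = b)
    {K : Type} [AddCommGroup K] [Module R K] {k : ℕ} {f : (Fin k → R) →ₗ[R] K}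
    (hf : FreeCover R K k f) (φ : K →ₛₗ[σ] S) :
    ∃ g : K →ₗ[R] R, ∀ m, σ (g m) = φ m := by
  obtain ⟨hs, hext⟩ := hf
  choose c hc using fun i : Fin k => hσ (φ (f (Pi.single i 1)))
  let g : (Fin k → R) →ₗ[R] R := Fintype.linearCombination R c
  have hg : ∀ v, σ (g v) = φ (f v) := by
    intro v
    conv_rhs => rw [pi_eq_sum_univ' v]
    simp [g, Fintype.linearCombination_apply, map_sum, hc]
  have h1 : ∀ v : LinearMap.ker f, ∃ a, g v = x * a := by
    intro v
    rw [← hker, hg, LinearMap.mem_ker.1 v.2, map_zero]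
  choose h hh using h1
  let h' : LinearMap.ker f →ₗ[R] R :=
    { toFun := h
      map_add' := fun a b => hx _ _ (by rw [mul_add, ← hh, ← hh, ← hh]; simp)
      map_smul' := fun r a => hx _ _ (by
        rw [← hh]; simp only [RingHom.id_apply, smul_eq_mul]
        rw [mul_left_comm, ← hh]; simp) }
  obtain ⟨ψ, hψ⟩ := hext h'
  have hle : LinearMap.ker f ≤ LinearMap.ker (g - x • ψ) := by
    intro v hv
    have := hψ ⟨v, hv⟩
    simp only [LinearMap.mem_ker, LinearMap.sub_apply, LinearMap.smul_apply, smul_eq_mul]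
    simp only at this
    rw [this, sub_eq_zero]
    exact hh ⟨v, hv⟩
  let e := f.quotKerEquivOfSurjective hs
  refine ⟨(Submodule.liftQ _ _ hle) ∘ₗ e.symm.toLinearMap, fun m => ?_⟩
  obtain ⟨v, rfl⟩ := hs m
  have : e.symm (f v) = Submodule.Quotient.mk v := by
    rw [LinearEquiv.symm_apply_eq]; rfl
  simp only [LinearMap.comp_apply, LinearEquiv.coe_coe, this, Submodule.liftQ_apply]
  simp only [LinearMap.sub_apply, LinearMap.smul_apply, smul_eq_mul, map_sub, map_mul, hg,
    (hker x).2 ⟨1, by simp⟩, zero_mul, sub_zero]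

lemma good_transfer {R S : Type} [CommRing R] [CommRing S] (σ : R →+* S)
    (hσ : Function.Surjective σ) (x : R) (hker : ∀ r, σ r = 0 ↔ ∃ a, r = x * a)
    (hx : ∀ a b : R, x * a = x * b → a = b)
    {E F : Type} [AddCommGroup E] [Module R E] [AddCommGroup F] [Module S F]
    (hE : Good R E) (hreg : ∀ m : E, x • m = 0 → m = 0)
    (π : E →ₛₗ[σ] F) (hπ : Function.Surjective π) (hπk : ∀ m, π m = 0 ↔ ∃ a, m = x • a) :
    Good S F := by
  obtain ⟨Q, hQ, hQE⟩ := hE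
  refine ⟨fun N => ∃ M : ModuleCat.{0} R, Q M ∧ (∀ m : M, x • m = 0 → m = 0) ∧
    ∃ π : M →ₛₗ[σ] N, Function.Surjective π ∧ ∀ m, π m = 0 ↔ ∃ a, m = x • a, ?_,
    ModuleCat.of R E, hQE, hreg, π, hπ, hπk⟩
  rintro N ⟨M, hM, hreg, π, hπ, hπk⟩
  obtain ⟨k, f, ⟨hs, hext⟩, hQK⟩ := hQ M hM
  obtain ⟨l, f₂, hf₂, -⟩ := hQ _ hQK
  let fb : (Fin k → S) →ₗ[S] N := Fintype.linearCombination S fun i => π (f (Pi.single i 1))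
  have hsum : ∀ v : Fin k → R, v = ∑ i, v i • (Pi.single i 1 : Fin k → R) := by
    intro v; exact pi_eq_sum_univ' v
  have hfb : ∀ v : Fin k → R, fb (fun i => σ (v i)) = π (f v) := by
    intro v
    conv_rhs => rw [hsum v]
    simp [fb, Fintype.linearCombination_apply, map_sum]
  have hlift : ∀ w : Fin k → S, ∃ v : Fin k → R, (fun i => σ (v i)) = w := fun w => by
    choose v hv using fun i => hσ (w i)
    exact ⟨v, funext hv⟩
  let π' : LinearMap.ker f →ₛₗ[σ] LinearMap.ker fb :=
    { toFun := fun v => ⟨fun i => σ (v.1 i), by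
        rw [LinearMap.mem_ker, hfb, LinearMap.mem_ker.1 v.2, map_zero]⟩
      map_add' := fun a b => by ext i; simp
      map_smul' := fun a b => by ext i; simp }
  have hπ' : Function.Surjective π' := by
    rintro ⟨w, hw⟩
    obtain ⟨v, rfl⟩ := hlift w
    rw [LinearMap.mem_ker, hfb, hπk] at hw
    obtain ⟨a, ha⟩ := hw
    obtain ⟨u, rfl⟩ := hs a
    refine ⟨⟨v - x • u, by simp [ha]⟩, ?_⟩
    ext i
    simp [π', (hker x).2 ⟨1, by simp⟩]
  refine ⟨k, fb, ⟨?_, ?_⟩, ModuleCat.of R (LinearMap.ker f), hQK, ?_, π', hπ', ?_⟩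
  · intro n
    obtain ⟨m, rfl⟩ := hπ n
    obtain ⟨v, rfl⟩ := hs m
    exact ⟨_, hfb v⟩
  · intro φ
    obtain ⟨g, hg⟩ := lift_functional σ hσ x hker hx hf₂ (φ.comp π')
    obtain ⟨ψ, hψ⟩ := hext g
    refine ⟨Fintype.linearCombination S fun i => σ (ψ (Pi.single i 1)), fun w => ?_⟩
    obtain ⟨v, rfl⟩ := hπ' w
    have := hg v
    rw [← hψ] at this
    simp only [LinearMap.comp_apply] at this
    rw [← this]
    conv_rhs => rw [hsum v.1]
    simp [π', Fintype.linearCombination_apply, map_sum]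
  · rintro ⟨v, hv⟩ h
    ext i
    have := congrFun (congrArg Subtype.val h) i
    simp at this
    exact hx _ _ (by simpa using this)
  · rintro ⟨v, hv⟩
    constructor
    · intro h
      have h1 : ∀ i, ∃ a, v i = x * a := fun i => by
        rw [← hker]; exact congrFun (congrArg Subtype.val h) i
      choose w hw using h1
      have hvw : v = x • w := funext hw
      refine ⟨⟨w, ?_⟩, Subtype.ext hvw⟩
      rw [LinearMap.mem_ker] at hv ⊢
      apply hreg
      rw [← map_smul, ← hvw, hv]
    · rintro ⟨a, ha⟩
      rw [ha]
      ext i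
      simp [π', (hker x).2 ⟨1, by simp⟩]

/-- "regular of dimension (at most) `d`" -/
def Reg (d : ℕ) (R : Type) [CommRing R] [IsLocalRing R] : Prop :=
  (∃ s : Finset R, Ideal.span (s : Set R) = IsLocalRing.maximalIdeal R ∧ s.card ≤ d) ∧
    (d : WithBot ℕ∞) ≤ ringKrullDim R

lemma reg_quot {d : ℕ} {R : Type} [CommRing R] [IsLocalRing R] [IsNoetherianRing R]
    (h : Reg (d + 1) R) {x : R} (hx : x ∈ IsLocalRing.maximalIdeal R)
    (hx2 : x ∉ IsLocalRing.maximalIdeal R ^ 2) [IsLocalRing (R ⧸ Ideal.span {x})] :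
    Reg d (R ⧸ Ideal.span {x}) := by
  classical
  obtain ⟨⟨s, hs, hcard⟩, hdim⟩ := h
  constructor
  · have hx' := hx
    rw [← hs, Submodule.mem_span_finset] at hx'
    obtain ⟨a, -, ha⟩ := hx'
    have hj : ∃ j ∈ s, IsUnit (a j) := by
      by_contra! hcon
      apply hx2
      rw [← ha]
      refine Ideal.sum_mem _ fun j hj => ?_
      rw [pow_two]
      refine Ideal.mul_mem_mul ?_ ?_
      · exact (IsLocalRing.mem_maximalIdeal _).2 (hcon j hj)
      · rw [← hs]; exact Ideal.subset_span hj
    obtain ⟨j, hjs, hju⟩ := hj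
    refine ⟨(s.erase j).image (Ideal.Quotient.mk (Ideal.span {x})), ?_, ?_⟩
    · have hmap : IsLocalRing.maximalIdeal (R ⧸ Ideal.span {x}) =
          (IsLocalRing.maximalIdeal R).map (Ideal.Quotient.mk (Ideal.span {x})) := by
        exact (IsLocalRing.map_maximalIdeal_of_surjective _ Ideal.Quotient.mk_surjective).symm
      rw [hmap, ← hs, Ideal.map_span]
      apply le_antisymm
      · apply Ideal.span_mono
        simp only [Finset.coe_image]
        exact Set.image_mono (by simp)
      · rw [Ideal.span_le]
        have key : ∀ y ∈ s, y ≠ j → Ideal.Quotient.mk (Ideal.span {x}) y ∈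
            Ideal.span (((s.erase j).image (Ideal.Quotient.mk (Ideal.span {x})) : Finset _) :
              Set (R ⧸ Ideal.span {x})) := by
          intro y hy hyj
          apply Ideal.subset_span
          simp only [Finset.coe_image]
          exact ⟨y, by simp [hy, hyj], rfl⟩
        rintro _ ⟨y, hy, rfl⟩
        by_cases hyj : y = j
        · subst hyj
          have h0 : Ideal.Quotient.mk (Ideal.span {x}) x = 0 :=
            Ideal.Quotient.eq_zero_iff_mem.2 (Ideal.mem_span_singleton_self x)
          rw [← Finset.add_sum_erase _ _ hjs] at ha
          have h1 := congrArg (Ideal.Quotient.mk (Ideal.span {x})) ha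
          rw [h0, map_add, smul_eq_mul, map_mul, add_eq_zero_iff_eq_neg] at h1
          have hu := hju.map (Ideal.Quotient.mk (Ideal.span {x}))
          have : Ideal.Quotient.mk (Ideal.span {x}) (a y) * Ideal.Quotient.mk (Ideal.span {x}) y ∈
            Ideal.span (((s.erase y).image (Ideal.Quotient.mk (Ideal.span {x})) : Finset _) :
              Set (R ⧸ Ideal.span {x})) := by
            rw [h1]
            refine neg_mem ?_
            rw [map_sum]
            refine Ideal.sum_mem _ fun i hi => ?_
            rw [smul_eq_mul, map_mul]
            apply Ideal.mul_mem_left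
            rw [Finset.mem_erase] at hi
            exact key i hi.2 hi.1
          exact (Ideal.unit_mul_mem_iff_mem _ hu).1 this
        · exact key y hy hyj
    · refine Finset.card_image_le.trans ?_
      rw [Finset.card_erase_of_mem hjs]; omega
  · have h1 := ringKrullDim_le_ringKrullDim_quotient_add_card ({x} : Finset R) (by
      simpa [IsLocalRing.ringJacobson_eq_maximalIdeal] using hx)
    rw [ringKrullDim_eq_of_ringEquiv (Ideal.quotEquivOfEq (J := Ideal.span {x}) (by simp)),
      Finset.card_singleton, Nat.cast_one] at h1
    have h2 := hdim.trans h1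
    push_cast at h2
    exact ENat.WithBot.add_le_add_one_right_iff.1 h2


lemma reg_zero_isField {R : Type} [CommRing R] [IsLocalRing R] (h : Reg 0 R) : IsField R := by
  obtain ⟨⟨s, hs, hc⟩, -⟩ := h
  rw [IsLocalRing.isField_iff_maximalIdeal_eq, ← hs]
  have : s = ∅ := by simpa using hc
  simp [this]

lemma not_le_minimal {d : ℕ} {R : Type} [CommRing R] [IsLocalRing R] [IsNoetherianRing R]
    (h : Reg (d + 1) R) (p : Ideal R) (hp : p ∈ minimalPrimes R) :
    ¬ IsLocalRing.maximalIdeal R ≤ p := by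
  intro hle
  have hpp : p.IsPrime := hp.1.1
  have : p = IsLocalRing.maximalIdeal R :=
    le_antisymm (IsLocalRing.le_maximalIdeal hpp.ne_top) hle
  have h0 : p.height = 0 := Ideal.height_eq_zero_iff.2 hp
  have h1 := IsLocalRing.maximalIdeal_height_eq_ringKrullDim (R := R)
  rw [← this, h0] at h1
  have h2 := h.2
  rw [← h1] at h2
  have : ((d + 1 : ℕ) : WithBot ℕ∞) ≤ ((0 : ℕ) : WithBot ℕ∞) := by exact_mod_cast h2
  rw [Nat.cast_le] at this
  omega

lemma not_le_sq {d : ℕ} {R : Type} [CommRing R] [IsLocalRing R] [IsNoetherianRing R]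
    (h : Reg (d + 1) R) :
    ¬ IsLocalRing.maximalIdeal R ≤ IsLocalRing.maximalIdeal R ^ 2 := by
  intro hle
  have h0 : IsLocalRing.maximalIdeal R = ⊥ := by
    apply Submodule.eq_bot_of_le_smul_of_le_jacobson_bot (IsLocalRing.maximalIdeal R) _
      (IsNoetherian.noetherian _)
    · rwa [smul_eq_mul, ← pow_two]
    · exact IsLocalRing.maximalIdeal_le_jacobson _
  obtain ⟨p, hp⟩ := Ideal.nonempty_minimalPrimes (I := (⊥ : Ideal R)) bot_ne_top
  exact not_le_minimal h p hp (h0 ▸ bot_le)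

lemma exists_good_elt {d : ℕ} {R : Type} [CommRing R] [IsLocalRing R] [IsNoetherianRing R]
    (h : Reg (d + 1) R) : ∃ x ∈ IsLocalRing.maximalIdeal R,
      x ∉ IsLocalRing.maximalIdeal R ^ 2 ∧ ∀ p ∈ minimalPrimes R, x ∉ p := by
  classical
  have hfin := minimalPrimes.finite_of_isNoetherianRing R
  by_contra! hcon
  have := (Ideal.subset_union_prime (f := fun I : Ideal R => I)
    (s := insert (IsLocalRing.maximalIdeal R ^ 2) hfin.toFinset)
    (IsLocalRing.maximalIdeal R ^ 2) (IsLocalRing.maximalIdeal R ^ 2) (by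
      intro i hi h1 _
      simp [h1] at hi
      exact hi.1.1) (I := IsLocalRing.maximalIdeal R)).1 (by
      intro x hx
      by_cases hx2 : x ∈ IsLocalRing.maximalIdeal R ^ 2
      · simp [hx2]
      · obtain ⟨p, hp, hxp⟩ := hcon x hx hx2
        simp only [Set.mem_iUnion]
        exact ⟨p, by simp [hp], hxp⟩)
  obtain ⟨i, hi, hle⟩ := this
  simp only [Finset.mem_insert, Set.Finite.mem_toFinset] at hi
  rcases hi with rfl | hi
  · exact not_le_sq h hle
  · exact not_le_minimal h i hi hle

lemma local_quot {R : Type} [CommRing R] [IsLocalRing R] {x : R}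
    (hx : x ∈ IsLocalRing.maximalIdeal R) : IsLocalRing (R ⧸ Ideal.span {x}) := by
  have : Nontrivial (R ⧸ Ideal.span {x}) := by
    rw [Ideal.Quotient.nontrivial_iff]
    intro h
    rw [Ideal.span_singleton_eq_top] at h
    exact hx h
  exact IsLocalRing.of_surjective' _ Ideal.Quotient.mk_surjective

lemma reg_isDomain (d : ℕ) : ∀ (R : Type) [CommRing R] [IsLocalRing R] [IsNoetherianRing R],
    Reg d R → IsDomain R := by
  induction d with
  | zero => intro R _ _ _ h; exact (reg_zero_isField h).isDomain
  | succ d ih =>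
    intro R _ _ _ h
    obtain ⟨x, hx, hx2, hxp⟩ := exists_good_elt h
    have := local_quot hx
    have hdom := ih _ (reg_quot h hx hx2)
    rw [Ideal.Quotient.isDomain_iff_prime] at hdom
    obtain ⟨p, hp, hple⟩ := Ideal.exists_minimalPrimes_le (I := ⊥) (J := Ideal.span {x}) bot_le
    have hpp : p.IsPrime := hp.1.1
    have h0 : p = ⊥ := by
      apply Submodule.eq_bot_of_le_smul_of_le_jacobson_bot (IsLocalRing.maximalIdeal R) _
        (IsNoetherian.noetherian _)
      · intro y hy
        obtain ⟨a, rfl⟩ := Ideal.mem_span_singleton'.1 (hple hy)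
        have : a ∈ p := (hpp.mem_or_mem hy).resolve_right (hxp p hp)
        rw [mul_comm]
        exact Ideal.mul_mem_mul hx this
      · exact IsLocalRing.maximalIdeal_le_jacobson _
    subst h0
    have : NoZeroDivisors R := ⟨fun {a b} hab => by
      have := hpp.mem_or_mem (x := a) (y := b) (by simp [hab])
      simpa using this⟩
    exact NoZeroDivisors.to_isDomain R

lemma good_free (d : ℕ) : ∀ (R : Type) [CommRing R] [IsLocalRing R] [IsNoetherianRing R],
    Reg d R → ∀ (E : Type) [AddCommGroup E] [Module R E] [Module.Finite R E],
    Good R E → Module.Free R E := by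
  induction d with
  | zero =>
    intro R _ _ _ h E _ _ _ _
    let := (reg_zero_isField h).toField
    infer_instance
  | succ d ih =>
    intro R _ _ _ h
    have := reg_isDomain _ R h
    obtain ⟨x, hx, hx2, -⟩ := exists_good_elt h
    have := local_quot hx
    have hx0 : x ≠ 0 := by rintro rfl; exact hx2 (zero_mem _)
    have hq := reg_quot h hx hx2
    have step : ∀ (E : Type) [AddCommGroup E] [Module R E] [Module.Finite R E],
        Good R E → (∀ m : E, x • m = 0 → m = 0) → Module.Free R E := by
      intro E _ _ _ hE hreg
      have : Module.FinitePresentation R E := Module.finitePresentation_of_finite R E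
      rw [← Module.free_quotSMulTop_iff_free R E (IsLocalRing.maximalIdeal_le_jacobson _ hx)
        (isSMulRegular_iff_right_eq_zero_of_smul.2 hreg)]
      have := Module.Finite.of_restrictScalars_finite R (R ⧸ Ideal.span {x}) (QuotSMulTop x E)
      apply ih _ hq
      refine good_transfer (Ideal.Quotient.mk (Ideal.span {x})) Ideal.Quotient.mk_surjective x
        (fun r => ?_) (fun a b hab => mul_left_cancel₀ hx0 hab) hE hreg
        { toFun := fun m => Submodule.Quotient.mk m
          map_add' := fun _ _ => rfl
          map_smul' := fun _ _ => rfl } (Submodule.Quotient.mk_surjective _) (fun m => ?_)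
      · rw [Ideal.Quotient.eq_zero_iff_mem, Ideal.mem_span_singleton]; rfl
      · change (Submodule.Quotient.mk m : QuotSMulTop x E) = 0 ↔ _
        rw [Submodule.Quotient.mk_eq_zero, Submodule.mem_smul_pointwise_iff_exists]
        simp [eq_comm]
    intro E _ _ _ hE
    obtain ⟨Q, hQ, hQE⟩ := hE
    obtain ⟨k, f, ⟨hs, hext⟩, hQK⟩ := hQ _ hQE
    change (Fin k → R) →ₗ[R] E at f
    have hfree : Module.Free R (LinearMap.ker f) := by
      refine step _ ⟨Q, hQ, hQK⟩ ?_
      rintro ⟨v, hv⟩ hm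
      ext i
      have := congrFun (congrArg Subtype.val hm) i
      simpa [hx0] using this
    let b := Module.Free.chooseBasis R (LinearMap.ker f)
    choose ψ hψ using fun i => hext (b.coord i)
    let r : (Fin k → R) →ₗ[R] LinearMap.ker f := ∑ i, (ψ i).smulRight (b i)
    have hr : ∀ v : LinearMap.ker f, r v = v := by
      intro v
      simp only [r, LinearMap.sum_apply, LinearMap.smulRight_apply]
      rw [← b.sum_repr v]
      refine Finset.sum_congr rfl fun i _ => ?_
      rw [b.sum_repr v, hψ]
      rfl
    have hle : LinearMap.ker f ≤
        LinearMap.ker (LinearMap.id - (LinearMap.ker f).subtype ∘ₗ r) := by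
      intro v hv
      have := hr ⟨v, hv⟩
      simp only at this
      simp [this]
    let e := f.quotKerEquivOfSurjective hs
    have hproj : Module.Projective R E := by
      refine Module.Projective.of_split (Submodule.liftQ _ _ hle ∘ₗ e.symm.toLinearMap) f ?_
      ext m
      obtain ⟨v, rfl⟩ := hs m
      have : e.symm (f v) = Submodule.Quotient.mk v := by
        rw [LinearEquiv.symm_apply_eq]; rfl
      simp only [LinearMap.comp_apply, LinearEquiv.coe_coe, this, Submodule.liftQ_apply]
      simp
    exact Module.free_of_flat_of_isLocalRing

lemma ext_subsingleton {R : Type} [CommRing R] (E Y : ModuleCat.{0} R) (i : ℕ)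
    (h : Subsingleton (((Ext R (ModuleCat.{0} R) (i + 1)).obj (Opposite.op E)).obj Y)) :
    Subsingleton (Abelian.Ext E Y (i + 1)) := by
  let P := projectiveResolution E
  have hz := (ModuleCat.isZero_iff_subsingleton.2 h).of_iso (P.isoExt (i + 1) Y).symm
  rw [← HomologicalComplex.exactAt_iff_isZero_homology,
    HomologicalComplex.exactAt_iff' _ i (i + 1) (i + 2) (by simp) (by simp),
    ShortComplex.moduleCat_exact_iff] at hz
  refine subsingleton_of_forall_eq 0 fun α => ?_
  obtain ⟨f, hf, rfl⟩ := P.extMk_surjective α (i + 2) rfl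
  rw [P.extMk_eq_zero_iff f (i + 2) rfl hf i rfl]
  exact hz f hf

lemma good_of_ext {R : Type} [CommRing R] [IsNoetherianRing R]
    (E : Type) [AddCommGroup E] [Module R E] [Module.Finite R E]
    (h : ∀ i : ℕ, Subsingleton (Abelian.Ext (ModuleCat.of R E) (ModuleCat.of R R) (i + 1))) :
    Good R E := by
  refine ⟨fun M => Module.Finite R M ∧
    ∀ i : ℕ, Subsingleton (Abelian.Ext M (ModuleCat.of R R) (i + 1)), ?_, ‹_›, h⟩
  rintro M ⟨hM, h⟩
  obtain ⟨k, f, hf⟩ := Module.Finite.exists_fin' R M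
  have hS := LinearMap.shortExact_shortComplexKer hf
  have : Projective f.shortComplexKer.X₂ := ModuleCat.projective_of_free (Pi.basisFun R (Fin k))
  refine ⟨k, f, ⟨hf, fun φ => ?_⟩, (inferInstance : Module.Finite R (LinearMap.ker f)), fun i => ?_⟩
  · obtain ⟨y, hy⟩ := Abelian.Ext.contravariant_sequence_exact₁ hS (ModuleCat.of R R)
      (Abelian.Ext.mk₀ (ModuleCat.ofHom φ)) (n₁ := 1) rfl (Subsingleton.elim (h := h 0) _ _)
    obtain ⟨g, rfl⟩ := (Abelian.Ext.mk₀_bijective _ _).2 y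
    rw [Abelian.Ext.mk₀_comp_mk₀] at hy
    have := (Abelian.Ext.mk₀_bijective _ _).1 hy
    exact ⟨g.hom, fun v => congrArg (fun t => t.hom v) this⟩
  · refine subsingleton_of_forall_eq 0 fun α => ?_
    obtain ⟨y, hy⟩ := Abelian.Ext.contravariant_sequence_exact₁ hS (ModuleCat.of R R)
      α (n₁ := 1 + (i + 1)) rfl (Subsingleton.elim (h := by rw [add_comm]; exact h (i + 1)) _ _)
    rw [← hy, Abelian.Ext.eq_zero_of_projective y, Abelian.Ext.comp_zero]

theorem free_iff_ext_vanishing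
    (R : Type) [CommRing R] [IsLocalRing R] [IsNoetherianRing R]
    (hreg : IsRegularLocal R)
    (E : Type) [AddCommGroup E] [Module R E] [Module.Finite R E] :
    Module.Free R E ↔
      ∀ i : ℕ, 0 < i →
        Subsingleton (((Ext R (ModuleCat.{0} R) i).obj
          (Opposite.op (ModuleCat.of R E))).obj (ModuleCat.of R R)) := by
  constructor
  · intro hfree i hi
    obtain ⟨i, rfl⟩ : ∃ j, i = j + 1 := ⟨i - 1, by omega⟩
    have : Projective (ModuleCat.of R E) :=
      ModuleCat.projective_of_free (Module.Free.chooseBasis R E)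
    exact ModuleCat.isZero_iff_subsingleton.1 (isZero_Ext_succ_of_projective _ _ i)
  · intro h
    obtain ⟨s, hs, hc⟩ := hreg
    exact good_free s.card R ⟨⟨s, hs, le_rfl⟩, hc.le⟩ E
      (good_of_ext E fun i => ext_subsingleton _ _ i (h (i + 1) i.succ_pos))
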